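/- Let P be a ℤ^d-invariant algebraic recurrence given by a finite index set 𝒜, finite multisets E_α of elements of ℤ^d and nonzero constants c_α ∈ ℂ, let ℓ : ℤ^d → ℤ be a linear functional, and suppose δ ≥ 1 and P is (δ−1)-homogeneous with respect to ℓ. Let γ be a nonzero complex number such that f₀(v) := γ^{ℓ(v)^δ} satisfies P at every v ∈ ℤ^d. Let f : ℝ × ℤ^d → ℂ be such that f(0,v) = f₀(v) for all v, the map t ↦ f(t,v) is differentiable at t = 0 for each v, and for every t ∈ ℝ the function f(t,·) satisfies P at every v ∈ ℤ^d. Define g(v) := (∂f/∂t)(0,v) / f₀(v). Then for every v ∈ ℤ^d, Σ_{α∈𝒜} c_α γ^{ℓ(α)} Σ_{w∈E_α} g(v+w) = 0, where ℓ(α) := Σ_{w∈E_α} ℓ(w)^δ. -/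

import Mathlib

/-- A function `f : ℤ^d → ℂ` satisfies the `ℤ^d`-invariant algebraic recurrence given by
the multisets `E α` and coefficients `c α` at the point `v`. -/
def SatisfiesRecAt {d : ℕ} {A : Type*} [Fintype A]
    (E : A → Multiset (Fin d → ℤ)) (c : A → ℂ) (f : (Fin d → ℤ) → ℂ)
    (v : Fin d → ℤ) : Prop :=
  ∑ α : A, c α * ((E α).map fun w => f (v + w)).prod = 0

/-- The recurrence given by `E` is `k`-homogeneous with respect to the linear
functional `ℓ`. -/
def IsHomogeneousRec {d : ℕ} {A : Type*} [Fintype A]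
    (E : A → Multiset (Fin d → ℤ)) (ℓ : (Fin d → ℤ) →ₗ[ℤ] ℤ) (k : ℕ) : Prop :=
  ∃ β : ℕ → ℤ, ∀ j ≤ k, ∀ α : A, ((E α).map fun w => ℓ w ^ j).sum = β j

theorem Multiset.prod_map_zpow_eq_zpow_sum {ι : Type*} {γ : ℂ} (hγ : γ ≠ 0) (s : Multiset ι)
    (e : ι → ℤ) : (s.map fun w => γ ^ e w).prod = γ ^ (s.map e).sum := by
  induction s using Multiset.induction_on with
  | empty => simp
  | cons a s ih => simp [ih, zpow_add₀ hγ]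

theorem Multiset.sum_map_add_pow {ι R : Type*} [CommSemiring R] (s : Multiset ι)
    (x : ι → R) (y : R) (n : ℕ) :
    (s.map fun w => (x w + y) ^ n).sum =
      ∑ j ∈ Finset.range (n + 1), (s.map fun w => x w ^ j).sum * (y ^ (n - j) * n.choose j) := by
  induction s using Multiset.induction_on with
  | empty => simp
  | cons a s ih =>
    simp only [Multiset.map_cons, Multiset.sum_cons, add_mul, Finset.sum_add_distrib]
    rw [ih, add_pow]
    simp only [mul_assoc]

/-- The derivative of a product over a multiset, in logarithmic form. -/
theorem HasDerivAt.multiset_prod_map_of_ne_zero {ι : Type*} {F : ℝ → ι → ℂ} {F' : ι → ℂ}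
    {t₀ : ℝ} (s : Multiset ι) (hF : ∀ w, HasDerivAt (fun t => F t w) (F' w) t₀)
    (hne : ∀ w, F t₀ w ≠ 0) :
    HasDerivAt (fun t => (s.map (F t)).prod)
      ((s.map (F t₀)).prod * (s.map fun w => F' w / F t₀ w).sum) t₀ := by
  induction s using Multiset.induction_on with
  | empty => simpa using hasDerivAt_const t₀ (1 : ℂ)
  | cons a s ih =>
    simp only [Multiset.map_cons, Multiset.prod_cons, Multiset.sum_cons]
    refine ((hF a).fun_mul ih).congr_deriv ?_
    have := hne a
    field_simp

/-- Translating a `(δ - 1)`-homogeneous recurrence changes the `δ`-th power sums of all its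
terms by the same amount. -/
theorem IsHomogeneousRec.exists_sum_map_pow_translate {d : ℕ} {A : Type*} [Fintype A]
    {E : A → Multiset (Fin d → ℤ)} {ℓ : (Fin d → ℤ) →ₗ[ℤ] ℤ} {δ : ℕ}
    (hhom : IsHomogeneousRec E ℓ (δ - 1)) (v : Fin d → ℤ) :
    ∃ K : ℤ, ∀ α, ((E α).map fun w => ℓ (v + w) ^ δ).sum =
      K + ((E α).map fun w => ℓ w ^ δ).sum := by
  obtain ⟨β, hβ⟩ := hhom
  refine ⟨∑ j ∈ Finset.range δ, β j * (ℓ v ^ (δ - j) * δ.choose j), fun α => ?_⟩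
  simp only [map_add, add_comm (ℓ v)]
  rw [Multiset.sum_map_add_pow, Finset.sum_range_succ]
  congr 1
  · refine Finset.sum_congr rfl fun j hj => ?_
    rw [hβ j (Nat.le_sub_one_of_lt (Finset.mem_range.mp hj)) α]
  · simp

theorem linear_recurrence_for_derivative {d : ℕ} {A : Type*} [Fintype A]
    (E : A → Multiset (Fin d → ℤ)) (c : A → ℂ) (hc : ∀ α, c α ≠ 0)
    (ℓ : (Fin d → ℤ) →ₗ[ℤ] ℤ) (δ : ℕ) (hδ : 1 ≤ δ)
    (hhom : IsHomogeneousRec E ℓ (δ - 1))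
    (γ : ℂ) (hγ : γ ≠ 0)
    (hγsol : ∀ v : Fin d → ℤ,
      SatisfiesRecAt E c (fun w => γ ^ ((ℓ w ^ δ : ℤ))) v)
    (f : ℝ → (Fin d → ℤ) → ℂ) (f' : (Fin d → ℤ) → ℂ)
    (hf0 : ∀ v : Fin d → ℤ, f 0 v = γ ^ ((ℓ v ^ δ : ℤ)))
    (hderiv : ∀ v : Fin d → ℤ, HasDerivAt (fun t : ℝ => f t v) (f' v) 0)
    (hfrec : ∀ t : ℝ, ∀ v : Fin d → ℤ, SatisfiesRecAt E c (f t) v) :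
    ∀ v : Fin d → ℤ,
      ∑ α : A, c α * γ ^ (((E α).map fun w => ℓ w ^ δ).sum) *
        ((E α).map fun w => f' (v + w) / γ ^ ((ℓ (v + w) ^ δ : ℤ))).sum = 0 := by
  intro v
  obtain ⟨K, hK⟩ := hhom.exists_sum_map_pow_translate v
  have hne : ∀ w, f 0 (v + w) ≠ 0 := fun w => by
    rw [hf0]
    exact zpow_ne_zero _ hγ
  have hD := HasDerivAt.fun_sum fun α (_ : α ∈ Finset.univ) =>
    (HasDerivAt.multiset_prod_map_of_ne_zero (E α) (fun w => hderiv (v + w)) hne).const_mul (c α)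
  have hzero : (fun t => ∑ α, c α * ((E α).map fun w => f t (v + w)).prod) = fun _ => 0 :=
    funext fun t => hfrec t v
  rw [hzero] at hD
  have h := hD.unique (hasDerivAt_const (0 : ℝ) (0 : ℂ))
  simp only [hf0, Multiset.prod_map_zpow_eq_zpow_sum hγ, hK, zpow_add₀ hγ] at h
  refine (mul_eq_zero_iff_left (zpow_ne_zero K hγ)).mp ?_
  rw [← h, Finset.mul_sum]
  exact Finset.sum_congr rfl fun α _ => by ring
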